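/- The only rational points $(x, y)$ on the elliptic curve $y^2 = x^3 + 64$ are $(8, 24)$, $(8, -24)$, $(0, 8)$, $(0, -8)$, and $(-4, 0)$. -/

import Mathlib

lemma cop3 {c : ℤ} (h : ¬ (3:ℤ) ∣ c) : IsCoprime (3:ℤ) c :=
  (Prime.coprime_iff_not_dvd Int.prime_three).2 h

lemma congC {a b a' b' : ℤ} (h : IsCoprime a b) (h1 : a = a') (h2 : b = b') :
    IsCoprime a' b' := h1 ▸ h2 ▸ h

lemma congD {a b a' b' : ℤ} (h : a ∣ b) (h1 : a = a') (h2 : b = b') : a' ∣ b' := h1 ▸ h2 ▸ h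

lemma copF {b c : ℤ} (h : IsCoprime b c) (h3 : ¬ (3:ℤ) ∣ c) :
    IsCoprime (b * c) (c^2 - 3*b*c + 3*b^2) := by
  have h1 : IsCoprime b (c^2 - 3*b*c + 3*b^2) := by
    have := (h.pow_right (n := 2)).add_mul_left_right (-3*c+3*b)
    exact congC this (by ring) (by ring)
  have h2 : IsCoprime c (c^2 - 3*b*c + 3*b^2) := by
    have := ((cop3 h3).symm.mul_right (h.symm.pow_right (n := 2))).add_mul_left_right (c-3*b)
    exact congC this (by ring) (by ring)
  exact h1.mul_left h2

lemma sq_of_mul {g s w : ℤ} (hg : g ≠ 0) (h : g^2 * s = w^2) : ∃ v, s = v^2 := by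
  have : g ∣ w := (Int.pow_dvd_pow_iff (n := 2) (by norm_num)).1 ⟨s, h.symm⟩
  obtain ⟨v, rfl⟩ := this
  refine ⟨v, ?_⟩
  have : g^2 ≠ 0 := pow_ne_zero _ hg
  apply mul_left_cancel₀ this
  rw [h]; ring

def PP (N : ℤ) : Prop := ∀ b c w : ℤ, 0 < b → 0 < c → IsCoprime b c → ¬ (3:ℤ) ∣ c →
  b * c < N → b * c * (c^2 - 3*b*c + 3*b^2) = w^2 → b = c

lemma Fpos {x y : ℤ} (hx : x ≠ 0) : 0 < y^2 - 3*x*y + 3*x^2 := by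
  have : 0 < x^2 := by positivity
  nlinarith [sq_nonneg (2*y - 3*x)]

lemma wrapper (N : ℤ) (hP : PP N) (x y M L w : ℤ) (hx : x ≠ 0) (hy : y ≠ 0)
    (hw : x * y * (y^2 - 3*x*y + 3*x^2) = w^2) (hM : M * (y^2 - 3*x*y + 3*x^2) = L * (x * y))
    (hM0 : 0 < M) (hMN : M < N) : y = x ∨ y = 3 * x := by
  obtain ⟨g, x0, y0, hg, hc, rfl, rfl, hx0⟩ : ∃ g x0 y0 : ℤ, g ≠ 0 ∧ IsCoprime x0 y0 ∧
      x = g * x0 ∧ y = g * y0 ∧ 0 < x0 := by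
    have hgp : 0 < Int.gcd x y := Int.gcd_pos_of_ne_zero_left _ hx
    obtain ⟨x0, y0, hc, h1, h2⟩ := Int.exists_gcd_one hgp
    rw [← Int.isCoprime_iff_gcd_eq_one] at hc
    have hg : ((Int.gcd x y : ℕ) : ℤ) ≠ 0 := by exact_mod_cast hgp.ne'
    rcases lt_trichotomy x0 0 with h | h | h
    · exact ⟨-(Int.gcd x y : ℤ), -x0, -y0, neg_ne_zero.2 hg, hc.neg_neg,
        by linarith, by linarith, by linarith⟩
    · exact absurd (by rw [h1, h]; ring) hx
    · exact ⟨(Int.gcd x y : ℤ), x0, y0, hg, hc, by linarith, by linarith, h⟩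
  have hF := Fpos (y := y0) hx0.ne'
  obtain ⟨v, hv⟩ : ∃ v, x0 * y0 * (y0^2 - 3*x0*y0 + 3*x0^2) = v^2 := by
    apply sq_of_mul (g := g^2) (w := w) (pow_ne_zero _ hg)
    rw [← hw]; ring
  have hM' : M * (y0^2 - 3*x0*y0 + 3*x0^2) = L * (x0 * y0) := by
    apply mul_left_cancel₀ (pow_ne_zero 2 hg)
    linear_combination hM
  have hy00 : y0 ≠ 0 := by rintro rfl; simp at hy
  have hy0 : 0 < y0 := by
    have h1 : 0 ≤ x0 * y0 := by
      by_contra hcon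
      push Not at hcon
      nlinarith [sq_nonneg v, mul_pos (neg_pos.2 hcon) hF]
    have h2 : 0 ≤ y0 := by
      by_contra hcon
      push Not at hcon
      nlinarith
    omega
  by_cases h3 : (3:ℤ) ∣ y0
  · right
    obtain ⟨u, rfl⟩ := h3
    have hu : 0 < u := by linarith
    have hcu : IsCoprime u x0 := hc.symm.of_mul_left_right
    have h3x : ¬ (3:ℤ) ∣ x0 := by
      have h3c : IsCoprime (3:ℤ) x0 := hc.symm.of_mul_left_left
      exact (Prime.coprime_iff_not_dvd Int.prime_three).1 h3c
    obtain ⟨z, hz⟩ : ∃ z, u * x0 * (x0^2 - 3*u*x0 + 3*u^2) = z^2 := by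
      apply sq_of_mul (g := 3) (w := v) (by norm_num)
      rw [← hv]; ring
    have hd : u * x0 ∣ M := by
      apply (copF hcu h3x).dvd_of_dvd_mul_right
      exact ⟨L, by linarith⟩
    have := Int.le_of_dvd hM0 hd
    have := hP u x0 z hu hx0 hcu h3x (by linarith) hz
    subst this; ring
  · left
    have hd : x0 * y0 ∣ M := by
      apply (copF hc h3).dvd_of_dvd_mul_right
      exact ⟨L, by linarith⟩
    have := Int.le_of_dvd hM0 hd
    rw [hP x0 y0 v hx0 hy0 hc h3 (by linarith) hv]

lemma sqpos {a b w : ℤ} (ha : 0 < a) (h : IsCoprime a b) (e : a * b = w^2) :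
    ∃ z, 0 < z ∧ a = z^2 := by
  obtain ⟨z, hz | hz⟩ := Int.sq_of_isCoprime h e
  · refine ⟨|z|, abs_pos.2 ?_, by rw [hz, sq_abs]⟩
    rintro rfl; simp at hz; omega
  · nlinarith [sq_nonneg z]

lemma eq_frac {b c X Y : ℤ} (h : IsCoprime b c) (h' : IsCoprime X Y) (e : b * Y = c * X) :
    (b = X ∧ c = Y) ∨ (b = -X ∧ c = -Y) := by
  have h1 : b ∣ X := h.dvd_of_dvd_mul_left ⟨Y, e.symm⟩
  have h2 : X ∣ b := h'.dvd_of_dvd_mul_right ⟨c, by linarith⟩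
  have h3 : c ∣ Y := h.symm.dvd_of_dvd_mul_left ⟨X, e⟩
  have h4 : Y ∣ c := h'.symm.dvd_of_dvd_mul_right ⟨b, by linarith⟩
  have h5 := Int.natAbs_eq_natAbs_iff.1 (Int.natAbs_eq_of_dvd_dvd h1 h2)
  have h6 := Int.natAbs_eq_natAbs_iff.1 (Int.natAbs_eq_of_dvd_dvd h3 h4)
  rcases h5 with rfl | rfl <;> rcases h6 with rfl | rfl
  · simp
  · have : b * Y = 0 := by linarith
    rcases mul_eq_zero.1 this with rfl | rfl <;> simp
  · have : X * c = 0 := by linarith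
    rcases mul_eq_zero.1 this with rfl | rfl <;> simp
  · simp

lemma mod3 {x y : ℤ} (hx : ¬ (3:ℤ) ∣ x) (h : (3:ℤ) ∣ x^2 + y^2) : False := by
  have h1 : x % 3 = 1 ∨ x % 3 = 2 := by omega
  have h2 : y % 3 = 0 ∨ y % 3 = 1 ∨ y % 3 = 2 := by omega
  have := Int.emod_eq_zero_of_dvd h
  rcases h1 with h1 | h1 <;> rcases h2 with h2 | h2 | h2 <;>
    simp [pow_two, Int.add_emod, Int.mul_emod, h1, h2] at this

lemma step (b c w : ℤ) (hb : 0 < b) (hc : 0 < c) (hbc : IsCoprime b c) (h3 : ¬ (3:ℤ) ∣ c)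
    (hw : b * c * (c^2 - 3*b*c + 3*b^2) = w^2) (hP : PP (b * c)) : b = c := by
  have hcF := copF hbc h3
  have hF := Fpos (y := c) hb.ne'
  obtain ⟨d, hd0, hd⟩ := sqpos hF hcF.symm (by rw [← hw]; ring)
  obtain ⟨s, hs0, hs⟩ := sqpos (mul_pos hb hc) hcF hw
  obtain ⟨β, hβ0, hβ⟩ := sqpos hb hbc hs
  obtain ⟨γ, hγ0, hγ⟩ := sqpos hc hbc.symm (by rw [← hs]; ring)
  obtain ⟨m, n, hmn, hn, e⟩ : ∃ m n : ℤ, IsCoprime m n ∧ 0 < n ∧ m * b = n * (c + d) := by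
    have hgp : 0 < Int.gcd (c+d) b := Int.gcd_pos_of_ne_zero_right _ hb.ne'
    obtain ⟨m, n, hc, h1, h2⟩ := Int.exists_gcd_one hgp
    rw [← Int.isCoprime_iff_gcd_eq_one] at hc
    have hg : (0:ℤ) < ((Int.gcd (c+d) b : ℕ) : ℤ) := by exact_mod_cast hgp
    generalize ((Int.gcd (c+d) b : ℕ) : ℤ) = g at *
    refine ⟨m, n, hc, ?_, ?_⟩
    · rw [h2] at hb; exact pos_of_mul_pos_left hb hg.le
    · rw [h1, h2]; ring
  have e2 : b * (3*n^2 - m^2) = c * (3*n^2 - 2*m*n) := by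
    apply mul_left_cancel₀ hb.ne'
    have : (d*n)^2 = (m*b - c*n)^2 := by congr 1; linarith
    linear_combination n^2 * hd + this
  by_cases h3m : (3:ℤ) ∣ m
  · obtain ⟨k, rfl⟩ := h3m
    have h3n : ¬ (3:ℤ) ∣ n :=
      (Prime.coprime_iff_not_dvd Int.prime_three).1 hmn.of_mul_left_left
    have hkn : IsCoprime k n := hmn.of_mul_left_right
    have e3 : b * (n^2 - 3*k^2) = c * (n * (n - 2*k)) := by linarith
    have hcop : IsCoprime (n * (n - 2*k)) (n^2 - 3*k^2) := by
      apply IsCoprime.mul_left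
      · have := ((cop3 h3n).symm.mul_right (hkn.symm.pow_right (n := 2))).neg_right.add_mul_left_right n
        exact congC this (by ring) (by ring)
      · have h1 : IsCoprime (n - 2*k) k := by
          have := hkn.symm.add_mul_left_left (-2)
          exact congC this (by ring) (by ring)
        have := (h1.pow_right (n := 2)).add_mul_left_right (n + 2*k)
        exact congC this (by ring) (by ring)
    rcases eq_frac hbc hcop e3 with ⟨hb', hc'⟩ | ⟨hb', hc'⟩
    · have hpos : 0 < n - 2*k := by
        rw [hb'] at hb; exact pos_of_mul_pos_right hb hn.le
      by_cases hk : k = 0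
      · subst hk; rw [hb', hc']; ring
      by_cases hlt : n - 2*k < b * c
      · have hγ' : γ^2 = n^2 - 3*k^2 := by linarith
        have hβ' : β^2 = n * (n-2*k) := by linarith
        have htu : (n+γ-k) * (n+γ-3*k) = 2*(n+γ)*(n-2*k) := by linear_combination hγ'
        have hFF : (n+γ-3*k)^2 - 3*(n+γ-k)*(n+γ-3*k) + 3*(n+γ-k)^2 = 2*n*(n+γ) := by
          linear_combination hγ'
        have hne : (n+γ-k) * (n+γ-3*k) ≠ 0 := by rw [htu]; positivity
        have := wrapper _ hP (n+γ-k) (n+γ-3*k) (n-2*k) n (2*(n+γ)*β)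
          (left_ne_zero_of_mul hne) (right_ne_zero_of_mul hne)
          (by rw [hFF, htu]; linear_combination (-4*(n+γ)^2) * hβ')
          (by rw [hFF, htu]; ring) hpos hlt
        rcases this with h | h
        · exact absurd (by linarith) hk
        · exfalso; linarith
      · exfalso
        have h1 : n * (n-2*k) ≤ n * (n-2*k) * c := by nlinarith
        rw [hb'] at hlt
        have hn1 : n = 1 := by
          by_contra hcon
          have : 2 ≤ n := by omega
          nlinarith
        subst hn1
        have : 0 < k^2 := by positivity
        linarith
    · exfalso
      apply mod3 (x := n) (y := γ) h3n
      exact ⟨k^2, by linarith⟩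
  · have e3 : b * (m^2 - 3*n^2) = c * (n * (2*m - 3*n)) := by linarith
    have hcop : IsCoprime (n * (2*m - 3*n)) (m^2 - 3*n^2) := by
      apply IsCoprime.mul_left
      · have := (hmn.symm.pow_right (n := 2)).add_mul_left_right (-3*n)
        exact congC this (by ring) (by ring)
      · apply isCoprime_of_prime_dvd
        · rintro ⟨h1, h2⟩
          have hm : m = 0 ∨ m ≠ 0 := eq_or_ne _ _
          have : 3 * n^2 = 0 := by nlinarith
          have : 0 < n^2 := by positivity
          linarith
        · intro z hz h1 h2
          have h4 : z ∣ 3 * n^2 := by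
            have := (h1.mul_right (2*m+3*n)).sub (h2.mul_right 4)
            exact congD this (by ring) (by ring)
          have hm2 : z ∣ m^2 := by
            have := h2.add h4
            exact congD this (by ring) (by ring)
          have hm := hz.dvd_of_dvd_pow hm2
          rcases hz.dvd_or_dvd h4 with h | h
          · have : Associated z 3 := hz.associated_of_dvd Int.prime_three h
            exact h3m (this.symm.dvd.trans hm)
          · exact hz.not_isUnit (hmn.isUnit_of_dvd' hm (hz.dvd_of_dvd_pow h))
    rcases eq_frac hbc hcop e3 with ⟨hb', hc'⟩ | ⟨hb', hc'⟩
    · have hpos : 0 < 2*m - 3*n := by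
        rw [hb'] at hb; exact pos_of_mul_pos_right hb hn.le
      have hm : 0 < m := by linarith
      have fin : m = 2*n → b = c := by
        rintro rfl; rw [hb', hc']; ring
      apply fin
      have hγ' : γ^2 = m^2 - 3*n^2 := by linarith
      have hβ' : β^2 = n * (2*m-3*n) := by linarith
      by_cases hlt : n < b * c
      · have hFF : (m+γ)^2 - 3*n*(m+γ) + 3*n^2 = (m+γ)*(2*m-3*n) := by
          linear_combination hγ'
        have := wrapper _ hP n (m+γ) n (2*m-3*n) ((m+γ)*β) hn.ne' (by positivity)
          (by rw [hFF]; linear_combination (-(m+γ)^2) * hβ')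
          (by rw [hFF]; ring) hn hlt
        apply mul_left_cancel₀ hn.ne'
        rcases this with h | h
        · have : γ = n - m := by linarith
          subst this
          linarith
        · have : γ = 3*n - m := by linarith
          subst this
          linarith
      · have h1 : n * (2*m-3*n) ≤ n * (2*m-3*n) * c := by nlinarith
        rw [hb'] at hlt
        have hq : 2*m-3*n = 1 := by
          by_contra hcon
          have h2c : 2 ≤ 2*m-3*n := by omega
          have := mul_le_mul_of_nonneg_left h2c hn.le
          apply hlt
          linarith
        rw [hq] at hlt
        have hc1 : c = 1 := by
          by_contra hcon
          have h2c : 2 ≤ c := by omega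
          have := mul_le_mul_of_nonneg_left h2c hn.le
          apply hlt
          linarith
        rw [hc1] at hc'
        have hm' : 2 * m = 3 * n + 1 := by linarith
        have : (2*m)^2 = (3*n+1)^2 := by rw [hm']
        have : (n-1)^2 = 0 := by linarith
        have : n - 1 = 0 := by simpa using this
        linarith
    · exfalso
      apply mod3 (x := m) (y := γ) h3m
      exact ⟨n^2, by linarith⟩

lemma PPall (N : ℕ) : PP N := by
  induction N with
  | zero =>
    intro b c w hb hc _ _ h
    have := mul_pos hb hc
    push_cast at h
    omega
  | succ N ih =>
    intro b c w hb hc h1 h2 h h3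
    apply step b c w hb hc h1 h2 h3
    intro b' c' w' hb' hc' h1' h2' h' h3'
    exact ih b' c' w' hb' hc' h1' h2' (by push_cast at h; omega) h3'

lemma final (x y w : ℤ) (hx : x ≠ 0) (hy : y ≠ 0)
    (hw : x * y * (y^2 - 3*x*y + 3*x^2) = w^2) : y = x ∨ y = 3 * x := by
  have hF := Fpos (y := y) hx
  have h1 : 0 ≤ x * y := by
    by_contra hcon
    push Not at hcon
    nlinarith [sq_nonneg w, mul_pos (neg_pos.2 hcon) hF]
  have h2 : 0 < x * y := lt_of_le_of_ne h1 (mul_ne_zero hx hy).symm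
  refine wrapper _ (PPall (x*y+1).toNat) x y (x*y) (y^2 - 3*x*y + 3*x^2) w hx hy hw (by ring) h2 ?_
  omega

theorem stmt_2 : ∀ x y : ℚ, y ^ 2 = x ^ 3 + 64 →
    (x, y) = (8, 24) ∨ (x, y) = (8, -24) ∨ (x, y) = (0, 8) ∨
    (x, y) = (0, -8) ∨ (x, y) = (-4, 0) := by
  intro x y h
  have key : x = 8 ∨ x = 0 ∨ x = -4 := by
    obtain ⟨X, hX⟩ : ∃ X : ℚ, x = 4 * X := ⟨x/4, by ring⟩
    obtain ⟨Y, hY⟩ : ∃ Y : ℚ, y = 8 * Y := ⟨y/8, by ring⟩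
    subst hX hY
    have h' : Y^2 = X^3 + 1 := by linarith
    have hd : (X.den : ℚ) ≠ 0 := by exact_mod_cast X.den_ne_zero
    have hXe : X * X.den = X.num := Rat.mul_den_eq_num X
    have hsq : IsSquare (((X.den : ℤ) * (X.num + X.den) * ((X.num + X.den)^2
        - 3 * (X.den : ℤ) * (X.num + X.den) + 3 * (X.den:ℤ)^2) : ℤ) : ℚ) := by
      refine ⟨Y * X.den^2, ?_⟩
      push_cast
      rw [← hXe]
      linear_combination (-(X.den:ℚ)^4) * h'
    rw [Rat.isSquare_intCast_iff] at hsq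
    obtain ⟨w, hw⟩ := hsq
    by_cases h0 : X.num + X.den = 0
    · right; right
      have : (X.num : ℚ) + X.den = 0 := by exact_mod_cast h0
      rw [← hXe] at this
      have : (X + 1) * X.den = 0 := by linarith
      have := (mul_eq_zero.1 this).resolve_right hd
      linarith
    · rcases final X.den (X.num + X.den) w (by exact_mod_cast X.den_ne_zero) h0
        (by rw [hw]; ring) with h1 | h1
      · right; left
        have : (X.num : ℚ) + X.den = X.den := by exact_mod_cast h1
        rw [← hXe] at this
        have : X * X.den = 0 := by linarith
        have := (mul_eq_zero.1 this).resolve_right hd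
        linarith
      · left
        have : (X.num : ℚ) + X.den = 3 * X.den := by exact_mod_cast h1
        rw [← hXe] at this
        have : (X - 2) * X.den = 0 := by linarith
        have := (mul_eq_zero.1 this).resolve_right hd
        linarith
  rcases key with rfl | rfl | rfl
  · have : (y - 24) * (y + 24) = 0 := by linarith
    rcases mul_eq_zero.1 this with h | h
    · left; rw [Prod.mk.injEq]; exact ⟨rfl, by linarith⟩
    · right; left; rw [Prod.mk.injEq]; exact ⟨rfl, by linarith⟩
  · have : (y - 8) * (y + 8) = 0 := by linarith
    rcases mul_eq_zero.1 this with h | h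
    · right; right; left; rw [Prod.mk.injEq]; exact ⟨rfl, by linarith⟩
    · right; right; right; left; rw [Prod.mk.injEq]; exact ⟨rfl, by linarith⟩
  · right; right; right; right
    have : y^2 = 0 := by linarith
    have : y = 0 := by simpa using this
    rw [this]
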